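/- arXiv:1201.1315 — 3 statements merged into one kernel-verified Lean document; each statement's English description precedes it below -/
import Mathlib

section
/- Let p be an odd prime and let f : ℤ_p → ℚ_p be continuous. Then the sequence N ↦ Σ_{x=0}^{p^N−1} (−1)^x f(x) converges in ℚ_p as N → ∞; that is, the fermionic p-adic integral I_{−1}(f) exists. -/
open Filter

theorem Finset.sum_range_mul_eq_sum_sum {M : Type*} [AddCommMonoid M] (g : ℕ → M) (m n : ℕ) :
    ∑ x ∈ Finset.range (m * n), g x =
      ∑ i ∈ Finset.range n, ∑ x ∈ Finset.range m, g (m * i + x) := by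
  induction n with
  | zero => simp
  | succ n ih => rw [Nat.mul_succ, Finset.sum_range_add, ih, Finset.sum_range_succ]

/-- The difference between consecutive partial sums of the fermionic integral is an alternating
sum of increments of `f` along translations by multiples of `p ^ N`. -/
theorem fermionic_sum_succ_sub {p : ℕ} [Fact p.Prime] (hp : p ≠ 2) (f : ℤ_[p] → ℚ_[p]) (N : ℕ) :
    ∑ x ∈ Finset.range (p ^ (N + 1)), (-1 : ℚ_[p]) ^ x * f (x : ℤ_[p]) -
      ∑ x ∈ Finset.range (p ^ N), (-1 : ℚ_[p]) ^ x * f (x : ℤ_[p]) =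
    ∑ i ∈ Finset.range p, ∑ x ∈ Finset.range (p ^ N),
      (-1 : ℚ_[p]) ^ (i + x) * (f ((p ^ N * i + x : ℕ) : ℤ_[p]) - f (x : ℤ_[p])) := by
  have hodd : Odd p := (Fact.out : p.Prime).odd_of_ne_two hp
  have hsum : ∑ i ∈ Finset.range p, (-1 : ℚ_[p]) ^ i = 1 := by
    rw [neg_one_geom_sum, if_neg (Nat.not_even_iff_odd.mpr hodd)]
  have hconst : ∑ x ∈ Finset.range (p ^ N), (-1 : ℚ_[p]) ^ x * f (x : ℤ_[p]) =
      ∑ i ∈ Finset.range p, ∑ x ∈ Finset.range (p ^ N),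
        (-1 : ℚ_[p]) ^ (i + x) * f (x : ℤ_[p]) := by
    simp_rw [pow_add, mul_assoc, ← Finset.mul_sum]
    rw [← Finset.sum_mul, hsum, one_mul]
  rw [hconst, pow_succ, Finset.sum_range_mul_eq_sum_sum, ← Finset.sum_sub_distrib]
  refine Finset.sum_congr rfl fun i _ => ?_
  rw [← Finset.sum_sub_distrib]
  refine Finset.sum_congr rfl fun x _ => ?_
  rw [pow_add (-1 : ℚ_[p]) (p ^ N * i), pow_mul, (hodd.pow).neg_one_pow, ← pow_add, mul_sub]

theorem fermionic_integral_exists (p : ℕ) [Fact p.Prime] (hp : p ≠ 2)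
    (f : ℤ_[p] → ℚ_[p]) (hf : Continuous f) :
    ∃ L : ℚ_[p], Filter.Tendsto
      (fun N : ℕ => ∑ x ∈ Finset.range (p ^ N), (-1 : ℚ_[p]) ^ x * f (x : ℤ_[p]))
      Filter.atTop (nhds L) := by
  apply cauchySeq_tendsto_of_complete
  apply NonarchimedeanAddGroup.cauchySeq_of_tendsto_sub_nhds_zero
  rw [Metric.tendsto_atTop]
  intro ε hε
  obtain ⟨δ, hδ, hfδ⟩ := Metric.uniformContinuous_iff.mp
    (CompactSpace.uniformContinuous_of_continuous hf) (ε / 2) (half_pos hε)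
  obtain ⟨k, hk⟩ := PadicInt.exists_pow_neg_lt p hδ
  refine ⟨k, fun N hN => ?_⟩
  rw [dist_zero_right, fermionic_sum_succ_sub hp]
  refine lt_of_le_of_lt ?_ (half_lt_self hε)
  refine IsUltrametricDist.norm_sum_le_of_forall_le_of_nonneg (half_pos hε).le fun i _ => ?_
  refine IsUltrametricDist.norm_sum_le_of_forall_le_of_nonneg (half_pos hε).le fun x _ => ?_
  rw [norm_mul, norm_pow, norm_neg, norm_one, one_pow, one_mul, ← dist_eq_norm]
  refine (hfδ ?_).le
  have hp1 : (1 : ℝ) ≤ p := mod_cast (Fact.out : p.Prime).one_le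
  rw [dist_eq_norm]
  push_cast
  rw [add_sub_cancel_right, norm_mul, PadicInt.norm_p_pow]
  calc (p : ℝ) ^ (-N : ℤ) * ‖(i : ℤ_[p])‖ ≤ (p : ℝ) ^ (-N : ℤ) :=
        mul_le_of_le_one_right (by positivity) (PadicInt.norm_le_one _)
    _ ≤ (p : ℝ) ^ (-k : ℤ) := zpow_le_zpow_right₀ hp1 (by omega)
    _ < δ := hk
end

section
/- Let p be an odd prime and let c ∈ ℤ_p satisfy |c − 1|_p < 1. Then for every n ∈ ℕ the fermionic moment E_n(c) := lim_{N→∞} Σ_{x=0}^{p^N−1} (−1)^x c^x x^n exists in ℚ_p, and these moments satisfy the Witt-type recurrence c·Σ_{j=0}^{n} C(n, j)·E_j(c) + E_n(c) = 2·δ_{n,0}, where δ_{n,0} = 1 if n = 0 and 0 otherwise, and C(n,j) is the binomial coefficient (with the convention 0^0 = 1 in the sums). -/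
open Filter

/-- The finite-level recurrence: the sum telescopes. -/
theorem mul_sum_choose_mul_sum_add_sum {R : Type*} [CommRing R] (c : R) (n M : ℕ) :
    c * (∑ j ∈ Finset.range (n + 1), (n.choose j : R) *
        ∑ x ∈ Finset.range M, (-1 : R) ^ x * c ^ x * (x : R) ^ j) +
      ∑ x ∈ Finset.range M, (-1 : R) ^ x * c ^ x * (x : R) ^ n =
    0 ^ n - (-1) ^ M * c ^ M * (M : R) ^ n := by
  have h : ∑ j ∈ Finset.range (n + 1), (n.choose j : R) *
        ∑ x ∈ Finset.range M, (-1 : R) ^ x * c ^ x * (x : R) ^ j =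
      ∑ x ∈ Finset.range M, (-1 : R) ^ x * c ^ x * ((x : R) + 1) ^ n := by
    simp_rw [Finset.mul_sum]
    rw [Finset.sum_comm]
    refine Finset.sum_congr rfl fun x _ => ?_
    rw [add_pow, Finset.mul_sum]
    refine Finset.sum_congr rfl fun j _ => ?_
    ring
  rw [h, Finset.mul_sum, ← Finset.sum_add_distrib]
  have key := Finset.sum_range_sub' (fun x : ℕ => (-1 : R) ^ x * c ^ x * (x : R) ^ n) M
  simp only [pow_zero, Nat.cast_zero, mul_one, one_mul] at key
  rw [← key]
  refine Finset.sum_congr rfl fun x _ => ?_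
  push_cast
  ring

theorem PadicInt.natCast_dvd_sub_one_of_norm_lt_one {p : ℕ} [Fact p.Prime] {c : ℤ_[p]}
    (hc : ‖c - 1‖ < 1) : (p : ℤ_[p]) ∣ c - 1 := by
  rwa [← PadicInt.norm_lt_one_iff_dvd]

theorem Padic.tendsto_natCast_prime_pow (p : ℕ) [Fact p.Prime] :
    Tendsto (fun N : ℕ => (p : ℚ_[p]) ^ N) atTop (nhds 0) :=
  tendsto_pow_atTop_nhds_zero_of_norm_lt_one Padic.norm_p_lt_one

theorem PadicInt.tendsto_pow_prime_pow {p : ℕ} [Fact p.Prime] {c : ℤ_[p]}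
    (hc : ‖c - 1‖ < 1) :
    Tendsto (fun N : ℕ => (c : ℚ_[p]) ^ p ^ N) atTop (nhds 1) := by
  rw [tendsto_iff_norm_sub_tendsto_zero]
  refine squeeze_zero (fun _ => norm_nonneg _) (fun N => ?_)
    (tendsto_zero_iff_norm_tendsto_zero.1 (Padic.tendsto_natCast_prime_pow p))
  obtain ⟨d, hd⟩ := dvd_sub_pow_of_dvd_sub
    (PadicInt.natCast_dvd_sub_one_of_norm_lt_one hc) N
  have h : (c : ℚ_[p]) ^ p ^ N - 1 = (p : ℚ_[p]) ^ N * ((p * d : ℤ_[p]) : ℚ_[p]) := by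
    have := congrArg (fun z : ℤ_[p] => (z : ℚ_[p])) hd
    push_cast at this
    rw [one_pow] at this
    rw [this]
    push_cast
    ring
  rw [h, norm_mul]
  exact mul_le_of_le_one_right (norm_nonneg _) (PadicInt.norm_le_one _)

theorem PadicInt.coe_add_one_ne_zero {p : ℕ} [Fact p.Prime] (hp : p ≠ 2) {c : ℤ_[p]}
    (hc : ‖c - 1‖ < 1) : (c : ℚ_[p]) + 1 ≠ 0 := by
  intro h
  have h' : c + 1 = 0 := by
    apply Subtype.ext
    push_cast
    exact h
  have h2 : c - 1 = -((2 : ℕ) : ℤ_[p]) := by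
    push_cast
    linear_combination h'
  rw [h2, norm_neg, PadicInt.norm_natCast_lt_one_iff,
    Nat.prime_dvd_prime_iff_eq Fact.out Nat.prime_two] at hc
  exact hp hc

theorem tendsto_fermionic_boundary {p : ℕ} [Fact p.Prime] (hp : p ≠ 2) {c : ℤ_[p]}
    (hc : ‖c - 1‖ < 1) (n : ℕ) :
    Tendsto (fun N : ℕ => (0 : ℚ_[p]) ^ n -
        (-1) ^ p ^ N * (c : ℚ_[p]) ^ p ^ N * ((p ^ N : ℕ) : ℚ_[p]) ^ n)
      atTop (nhds (if n = 0 then 2 else 0)) := by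
  have hodd : ∀ N : ℕ, (-1 : ℚ_[p]) ^ p ^ N = -1 := fun N =>
    (((Fact.out : p.Prime).odd_of_ne_two hp).pow).neg_one_pow
  have hlim := (tendsto_const_nhds (x := (0 : ℚ_[p]) ^ n)).add
    ((PadicInt.tendsto_pow_prime_pow hc).mul ((Padic.tendsto_natCast_prime_pow p).pow n))
  have hval : (0 : ℚ_[p]) ^ n + 1 * 0 ^ n = if n = 0 then 2 else 0 := by
    split_ifs with h
    · subst h
      norm_num
    · simp [h]
  rw [hval] at hlim
  refine hlim.congr fun N => ?_
  rw [hodd]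
  push_cast
  ring

theorem exists_tendsto_fermionic_sum {p : ℕ} [Fact p.Prime] (hp : p ≠ 2) {c : ℤ_[p]}
    (hc : ‖c - 1‖ < 1) (n : ℕ) :
    ∃ e : ℚ_[p], Tendsto (fun N : ℕ => ∑ x ∈ Finset.range (p ^ N),
      (-1 : ℚ_[p]) ^ x * (c : ℚ_[p]) ^ x * (x : ℚ_[p]) ^ n) atTop (nhds e) := by
  induction n using Nat.strong_induction_on with
  | _ n ih =>
    choose! e he using ih
    have hsum := tendsto_finsetSum (Finset.range n) fun j hj =>
      (he j (Finset.mem_range.1 hj)).const_mul (n.choose j : ℚ_[p])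
    refine ⟨_, (((tendsto_fermionic_boundary hp hc n).sub
      (hsum.const_mul (c : ℚ_[p]))).div_const ((c : ℚ_[p]) + 1)).congr fun N => ?_⟩
    rw [div_eq_iff (PadicInt.coe_add_one_ne_zero hp hc),
      ← mul_sum_choose_mul_sum_add_sum, Finset.sum_range_succ, Nat.choose_self, Nat.cast_one]
    ring

theorem fermionic_moments_recurrence (p : ℕ) [Fact p.Prime] (hp : p ≠ 2)
    (c : ℤ_[p]) (hc : ‖c - 1‖ < 1) :
    ∃ E : ℕ → ℚ_[p],
      (∀ n : ℕ, Filter.Tendsto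
        (fun N : ℕ => ∑ x ∈ Finset.range (p ^ N),
          (-1 : ℚ_[p]) ^ x * ((c : ℚ_[p])) ^ x * (x : ℚ_[p]) ^ n)
        Filter.atTop (nhds (E n))) ∧
      ∀ n : ℕ,
        (c : ℚ_[p]) * (∑ j ∈ Finset.range (n + 1), (n.choose j : ℚ_[p]) * E j) + E n =
          if n = 0 then 2 else 0 := by
  choose E hE using exists_tendsto_fermionic_sum hp hc
  refine ⟨E, hE, fun n => ?_⟩
  have hlim := ((tendsto_finsetSum (Finset.range (n + 1)) fun j _ =>
    (hE j).const_mul (n.choose j : ℚ_[p])).const_mul (c : ℚ_[p])).add (hE n)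
  refine tendsto_nhds_unique hlim ((tendsto_fermionic_boundary hp hc n).congr fun N => ?_)
  exact (mul_sum_choose_mul_sum_add_sum _ _ _).symm
end

section
/- Let p be an odd prime, let c ∈ ℤ_p satisfy |c − 1|_p < 1, let x₀ ∈ ℚ_p, and let d be an odd positive integer. Then for every n ∈ ℕ the fermionic moments satisfy the distribution formula E_n(x₀, c) = d^n · Σ_{j=0}^{d−1} (−1)^j · c^j · E_n((x₀ + j)/d, c^d), where all moments exist in ℚ_p (note |c^d − 1|_p < 1). -/
open Filter

/-- The alternating geometric moments `∑_{x < m} (-1)^x c^x (a + x)^n` converge along odd `m` with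
`m → 0` and `c ^ m → 1`, and the limit does not depend on how `m` approaches `0`. -/
theorem exists_tendsto_alternating_moment {K : Type*} [Field K] [TopologicalSpace K]
    [IsTopologicalRing K] (a c : K) (hc : 1 + c ≠ 0) (n : ℕ) :
    ∃ L : K, ∀ m : ℕ → ℕ, (∀ N, Odd (m N)) →
      Tendsto (fun N => (m N : K)) atTop (nhds 0) →
      Tendsto (fun N => c ^ m N) atTop (nhds 1) →
      Tendsto (fun N => ∑ x ∈ Finset.range (m N), (-1 : K) ^ x * c ^ x * (a + (x : K)) ^ n)
        atTop (nhds L) := by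
  induction n using Nat.strong_induction_on with
  | _ n ih =>
  choose! L hL using ih
  refine ⟨(1 + c)⁻¹ * (a ^ n + 1 * (a + 0) ^ n -
    c * ∑ i ∈ Finset.range n, L i * (n.choose i : K)), fun m hodd hm hcm => ?_⟩
  have recurrence (N : ℕ) :
      ∑ x ∈ Finset.range (m N), (-1 : K) ^ x * c ^ x * (a + (x : K)) ^ n =
      (1 + c)⁻¹ * (a ^ n + c ^ m N * (a + (m N : K)) ^ n - c * ∑ i ∈ Finset.range n,
        (∑ x ∈ Finset.range (m N), (-1 : K) ^ x * c ^ x * (a + (x : K)) ^ i) *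
          (n.choose i : K)) := by
    have telescope := Finset.sum_range_sub'
      (fun x : ℕ => (-1 : K) ^ x * c ^ x * (a + (x : K)) ^ n) (m N)
    simp only [(hodd N).neg_one_pow, pow_zero, Nat.cast_zero, add_zero] at telescope
    have expand : ∀ x : ℕ, (-1 : K) ^ x * c ^ x * (a + (x : K)) ^ n -
        (-1 : K) ^ (x + 1) * c ^ (x + 1) * (a + ((x + 1 : ℕ) : K)) ^ n =
        (1 + c) * ((-1 : K) ^ x * c ^ x * (a + (x : K)) ^ n) +
        c * ∑ i ∈ Finset.range n, (-1 : K) ^ x * c ^ x * (a + (x : K)) ^ i *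
          (n.choose i : K) := by
      intro x
      have binomial := add_pow (a + (x : K)) 1 n
      simp only [one_pow, mul_one, Finset.sum_range_succ, Nat.choose_self, Nat.cast_one]
        at binomial
      simp only [mul_assoc _ _ (Nat.cast _), ← Finset.mul_sum, Nat.cast_add, Nat.cast_one,
        ← add_assoc, binomial]
      ring
    rw [Finset.sum_congr rfl fun x _ => expand x, Finset.sum_add_distrib, ← Finset.mul_sum,
      ← Finset.mul_sum, Finset.sum_comm] at telescope
    simp only [← Finset.sum_mul] at telescope
    rw [eq_inv_mul_iff_mul_eq₀ hc]
    linear_combination telescope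
  simp only [recurrence]
  refine Tendsto.const_mul _ (Tendsto.sub
    (tendsto_const_nhds.add (hcm.mul ((tendsto_const_nhds.add hm).pow n))) ?_)
  exact Tendsto.const_mul _ (tendsto_finsetSum _ fun i hi =>
    (hL i (Finset.mem_range.mp hi) m hodd hm hcm).mul_const _)

theorem sum_range_mul_eq_sum_residues {M : Type*} [AddCommMonoid M] (f : ℕ → M) (d k : ℕ) :
    ∑ x ∈ Finset.range (d * k), f x =
      ∑ j ∈ Finset.range d, ∑ y ∈ Finset.range k, f (j + d * y) := by
  induction k with
  | zero => simp
  | succ k ih =>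
    rw [Nat.mul_succ, Finset.sum_range_add, ih]
    simp only [Finset.sum_range_succ _ k, Finset.sum_add_distrib, add_comm (d * k)]

theorem alternating_moment_mul {K : Type*} [Field K] (a c : K) {d : ℕ} (hd : Odd d)
    (hd₀ : (d : K) ≠ 0) (n k : ℕ) :
    ∑ x ∈ Finset.range (d * k), (-1 : K) ^ x * c ^ x * (a + (x : K)) ^ n =
      (d : K) ^ n * ∑ j ∈ Finset.range d, (-1 : K) ^ j * c ^ j *
        ∑ y ∈ Finset.range k, (-1 : K) ^ y * (c ^ d) ^ y * ((a + (j : K)) / d + (y : K)) ^ n := by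
  rw [sum_range_mul_eq_sum_residues, Finset.mul_sum]
  refine Finset.sum_congr rfl fun j _ => ?_
  rw [Finset.mul_sum, Finset.mul_sum]
  refine Finset.sum_congr rfl fun y _ => ?_
  have scale : a + ((j + d * y : ℕ) : K) = d * ((a + (j : K)) / d + y) := by
    push_cast
    field_simp
    ring
  rw [scale, mul_pow, pow_add, pow_mul, hd.neg_one_pow, pow_add, pow_mul]
  ring

theorem PadicInt.one_add_coe_ne_zero {p : ℕ} [Fact p.Prime] (hp : p ≠ 2) {c : ℤ_[p]}
    (hc : ‖c - 1‖ < 1) : 1 + (c : ℚ_[p]) ≠ 0 := by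
  intro h
  have hneg : c = -1 := by
    apply Subtype.coe_injective
    push_cast
    linear_combination h
  have htwo : ‖((2 : ℤ) : ℤ_[p])‖ < 1 := by
    have htwo_eq : ((2 : ℤ) : ℤ_[p]) = -(-1 - 1) := by norm_num
    rwa [htwo_eq, norm_neg, ← hneg]
  rw [PadicInt.norm_int_lt_one_iff_dvd] at htwo
  exact hp ((Nat.prime_dvd_prime_iff_eq Fact.out Nat.prime_two).mp (by exact_mod_cast htwo))

theorem fermionic_moments_distribution_formula (p : ℕ) [Fact p.Prime] (hp : p ≠ 2)
    (c : ℤ_[p]) (hc : ‖c - 1‖ < 1) (x₀ : ℚ_[p]) (d : ℕ) (hd : 0 < d) (hdo : Odd d)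
    (n : ℕ) :
    ∃ (L : ℚ_[p]) (M : ℕ → ℚ_[p]),
      Filter.Tendsto
        (fun N : ℕ => ∑ x ∈ Finset.range (p ^ N),
          (-1 : ℚ_[p]) ^ x * ((c : ℚ_[p])) ^ x * (x₀ + (x : ℚ_[p])) ^ n)
        Filter.atTop (nhds L) ∧
      (∀ j : ℕ, j < d → Filter.Tendsto
        (fun N : ℕ => ∑ x ∈ Finset.range (p ^ N),
          (-1 : ℚ_[p]) ^ x * (((c ^ d : ℤ_[p]) : ℚ_[p])) ^ x *
            ((x₀ + (j : ℚ_[p])) / (d : ℚ_[p]) + (x : ℚ_[p])) ^ n)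
        Filter.atTop (nhds (M j))) ∧
      L = (d : ℚ_[p]) ^ n *
        ∑ j ∈ Finset.range d, (-1 : ℚ_[p]) ^ j * ((c : ℚ_[p])) ^ j * M j := by
  have hodd (N : ℕ) : Odd (p ^ N) := ((Fact.out : p.Prime).odd_of_ne_two hp).pow
  have hpow : Tendsto (fun N : ℕ => ((p ^ N : ℕ) : ℚ_[p])) atTop (nhds 0) := by
    simp only [Nat.cast_pow]
    exact tendsto_pow_atTop_nhds_zero_of_norm_lt_one Padic.norm_p_lt_one
  have hcd : ‖c ^ d - 1‖ < 1 := by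
    rw [PadicInt.norm_lt_one_iff_dvd] at hc ⊢
    exact hc.trans (sub_one_dvd_pow_sub_one c d)
  have hcpow := PadicInt.tendsto_pow_prime_pow hc
  obtain ⟨L, hL⟩ := exists_tendsto_alternating_moment x₀ (c : ℚ_[p])
    (PadicInt.one_add_coe_ne_zero hp hc) n
  choose M hM using fun j : ℕ => exists_tendsto_alternating_moment ((x₀ + (j : ℚ_[p])) / d)
    ((c ^ d : ℤ_[p]) : ℚ_[p]) (PadicInt.one_add_coe_ne_zero hp hcd) n
  have hM' (j : ℕ) := hM j _ hodd hpow (PadicInt.tendsto_pow_prime_pow hcd)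
  refine ⟨L, M, hL _ hodd hpow hcpow, fun j _ => hM' j, ?_⟩
  have hL' := hL (fun N => d * p ^ N) (fun N => hdo.mul (hodd N))
    (by simpa using hpow.const_mul (d : ℚ_[p]))
    (by simpa only [mul_comm d, pow_mul, one_pow] using hcpow.pow d)
  refine tendsto_nhds_unique hL' ?_
  simp only [alternating_moment_mul x₀ (c : ℚ_[p]) hdo (Nat.cast_ne_zero.mpr hd.ne')]
  simp only [PadicInt.coe_pow] at hM'
  exact Tendsto.const_mul _ (tendsto_finsetSum _ fun j _ => (hM' j).const_mul _)
end
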